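/- arXiv:math/0503452 — 5 statements merged into one kernel-verified Lean document; each statement's English description precedes it below -/
import Mathlib

section
/- With the order/conductor setup below: the quotient A'⧸c is finite and Nat.card(A'⧸c) ≤ Nat.card(A'⧸R)^r. -/
open scoped TensorProduct

theorem Module.nonempty_basis_baseChange_of_finite_maximalSpectrum
    {A : Type*} (B P : Type*) [CommRing A] [IsDomain A] [CommRing B] [Algebra A B]
    [Finite (MaximalSpectrum B)] [AddCommGroup P] [Module A P] [Module.Finite A P]
    [Module.Flat A P] :
    Nonempty (Module.Basis (Fin (Module.finrank A P)) B (B ⊗[A] P)) := by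
  refine Module.nonempty_basis_of_flat_of_finrank_eq B (B ⊗[A] P) _ fun m ↦ ?_
  have := m.isMaximal
  let _ := Ideal.Quotient.field m.asIdeal
  rw [(TensorProduct.AlgebraTensorModule.cancelBaseChange A B (B ⧸ m.asIdeal)
    (B ⧸ m.asIdeal) P).finrank_eq]
  have h := Module.rankAtStalk_baseChange (R := A) (M := P) (S := B ⧸ m.asIdeal) ⊥
  rw [Module.rankAtStalk_eq_finrank_of_free] at h
  rw [Module.rankAtStalk_eq, Ideal.finrank_fiber_eq_finrank] at h
  simpa using h

theorem Module.finite_quotient_annihilator (A M : Type*) [CommRing A] [AddCommGroup M]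
    [Module A M] [Finite M] : Finite (A ⧸ Module.annihilator A M) := by
  have : Finite (AddMonoid.End M) := DFunLike.finite (M →+ M)
  exact _root_.Finite.of_injective _
    (RingHom.kerLift_injective (Module.toAddMonoidEnd A M))

theorem Module.finite_linearMap_and_natCard_eq
    (A P M : Type*) [CommRing A] [IsDomain A] [AddCommGroup P] [Module A P]
    [Module.Finite A P] [Module.Flat A P] [AddCommGroup M] [Module A M] [Finite M] :
    Finite (P →ₗ[A] M) ∧ Nat.card (P →ₗ[A] M) = Nat.card M ^ Module.finrank A P := by
  let B := A ⧸ Module.annihilator A M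
  let hM : Module.IsTorsionBySet A M (Module.annihilator A M) :=
    Module.isTorsionBySet_annihilator A M
  let _ : Module B M := hM.module
  have : IsScalarTower A B M := hM.isScalarTower
  have : Finite B := Module.finite_quotient_annihilator A M
  obtain ⟨b⟩ := Module.nonempty_basis_baseChange_of_finite_maximalSpectrum (A := A) B P
  let e : (P →ₗ[A] M) ≃ (Fin (Module.finrank A P) → M) :=
    (LinearMap.liftBaseChangeEquiv B).toEquiv.trans (b.constr ℕ).symm.toEquiv
  exact ⟨_root_.Finite.of_equiv _ e.symm, by simp [Nat.card_congr e, Nat.card_fun]⟩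

/-- Order/conductor setup: `A` a Dedekind domain with fraction field `K`, `K'` a finite
extension of `K` of degree `r`, `A'` the integral closure of `A` in `K'`, finitely
generated as an `A`-module, `R` a subring of `A'` containing `A` (i.e. an `A`-subalgebra)
with finite quotient `A-`module `A'⧸R`, and `c = {x ∈ A' : x·A' ⊆ R}` the conductor.
Then `A'⧸c` is finite and `Nat.card (A'⧸c) ≤ Nat.card (A'⧸R) ^ r`. -/
theorem stmt2
    {A K K' A' : Type*} [CommRing A] [IsDomain A] [IsDedekindDomain A]
    [Field K] [Algebra A K] [IsFractionRing A K]
    [Field K'] [Algebra K K'] [FiniteDimensional K K']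
    (r : ℕ) (hr : Module.finrank K K' = r)
    [CommRing A'] [IsDomain A'] [Algebra A A'] [Algebra A' K'] [Algebra A K']
    [IsScalarTower A A' K'] [IsScalarTower A K K']
    [IsIntegralClosure A' A K']
    [Module.Finite A A']
    (R : Subalgebra A A') [Finite (A' ⧸ Subalgebra.toSubmodule R)]
    (c : Ideal A') (hc : ∀ x : A', x ∈ c ↔ ∀ y : A', x * y ∈ R) :
    Finite (A' ⧸ c) ∧
      Nat.card (A' ⧸ c) ≤ Nat.card (A' ⧸ Subalgebra.toSubmodule R) ^ r := by
  have : Module.IsTorsionFree A K' := .trans_faithfulSMul A K K'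
  have : Module.IsTorsionFree A A' := IsIntegralClosure.isTorsionFree A K'
  have : IsFractionRing A' K' :=
    IsIntegralClosure.isFractionRing_of_finite_extension A K K' A'
  have hrank : Module.finrank A A' = r :=
    hr ▸ (IsFractionRing.finrank_eq A K A' K').symm
  obtain ⟨_, hcard⟩ := Module.finite_linearMap_and_natCard_eq A A'
    (A' ⧸ Subalgebra.toSubmodule R)
  let f : A' →ₗ[A] A' →ₗ[A] A' ⧸ Subalgebra.toSubmodule R :=
    (LinearMap.mul A A').compr₂ (Subalgebra.toSubmodule R).mkQ
  have hf (x : A') : x ∈ c ↔ f x = 0 := by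
    simp [hc, f, LinearMap.ext_iff]
  let g : A' ⧸ c →+ A' →ₗ[A] A' ⧸ Subalgebra.toSubmodule R :=
    QuotientAddGroup.lift c.toAddSubgroup f.toAddMonoidHom fun x hx ↦ (hf x).1 hx
  have hg : Function.Injective g := by
    rw [injective_iff_map_eq_zero]
    intro x
    obtain ⟨x, rfl⟩ := Ideal.Quotient.mk_surjective x
    intro hx
    exact Ideal.Quotient.eq_zero_iff_mem.2 ((hf x).2 hx)
  exact ⟨Finite.of_injective g hg, hrank ▸ hcard ▸ Nat.card_le_card_of_injective g hg⟩
end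

section
/- Let D be a Dedekind domain and let I be a nonzero ideal of D such that the quotient ring D⧸I is finite. Then, as an identity of rational numbers, Nat.card((D⧸I)ˣ) = Nat.card(D⧸I) · ∏_{𝔭} (1 − 1/Nat.card(D⧸𝔭)), where the product runs over the finitely many prime ideals 𝔭 of D containing I. -/
/-- The units of a finite ring with a surjective local homomorphism to a field `K` form the
complement of the kernel, a proportion `1 - 1 / |K|` of the ring. -/
theorem RingHom.natCard_units_eq_of_surjective {A K : Type*} [CommRing A] [Field K] [_root_.Finite A]
    (f : A →+* K) [IsLocalHom f] (hf : Function.Surjective f) :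
    (Nat.card Aˣ : ℚ) = Nat.card A * (1 - 1 / (Nat.card K : ℚ)) := by
  have : _root_.Finite K := _root_.Finite.of_surjective f hf
  have card_eq : Nat.card A = Nat.card (RingHom.ker f) * Nat.card K := by
    rw [Submodule.card_eq_card_quotient_mul_card (RingHom.ker f),
      Nat.card_congr (RingHom.quotientKerEquivOfSurjective hf).toEquiv]
  have units_eq : Nat.card Aˣ = Set.ncard (RingHom.ker f : Set A)ᶜ := by
    rw [← Nat.card_coe_set_eq]
    refine Nat.card_congr (Submonoid.unitsTypeEquivIsUnitSubmonoid.toEquiv.trans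
      (Equiv.subtypeEquivRight fun a ↦ ?_))
    rw [Set.mem_compl_iff, SetLike.mem_coe, RingHom.mem_ker, ← ne_eq, ← isUnit_iff_ne_zero,
      isUnit_map_iff, IsUnit.mem_submonoid_iff]
  have compl_eq : Nat.card (RingHom.ker f) + Nat.card Aˣ = Nat.card A := by
    rw [units_eq, ← Set.ncard_add_ncard_compl (RingHom.ker f : Set A)]
    rfl
  have card_ne : (Nat.card K : ℚ) ≠ 0 := mod_cast Nat.card_pos.ne'
  have compl_eq' : (Nat.card (RingHom.ker f) : ℚ) + Nat.card Aˣ = Nat.card A :=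
    mod_cast compl_eq
  have card_eq' : (Nat.card A : ℚ) = Nat.card (RingHom.ker f) * Nat.card K :=
    mod_cast card_eq
  field_simp
  linear_combination (Nat.card K : ℚ) * compl_eq' + card_eq'

/-- The totient formula for the quotient by a power of a maximal ideal. -/
theorem Ideal.natCard_units_quotient_pow {R : Type*} [CommRing R] (P : Ideal R) [P.IsMaximal]
    {n : ℕ} (hn : n ≠ 0) [Finite (R ⧸ P ^ n)] :
    (Nat.card (R ⧸ P ^ n)ˣ : ℚ) =
      Nat.card (R ⧸ P ^ n) * (1 - 1 / (Nat.card (R ⧸ P) : ℚ)) := by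
  let := Ideal.Quotient.field P
  have : IsLocalHom (Ideal.Quotient.factor (Ideal.pow_le_self (I := P) hn)) := by
    refine ⟨fun a ha ↦ ?_⟩
    obtain ⟨x, rfl⟩ := Ideal.Quotient.mk_surjective a
    exact (Ideal.Quotient.isUnit_mk_pow_iff_isUnit_mk P hn).mpr ha
  exact RingHom.natCard_units_eq_of_surjective _
    (Ideal.Quotient.factor_surjective (Ideal.pow_le_self hn))

/-- Generalized Euler totient formula: for a nonzero ideal `I` of a Dedekind domain `D`
with finite quotient, `|(D⧸I)ˣ| = |D⧸I| · ∏_{𝔭 prime, 𝔭 ⊇ I} (1 − 1/|D⧸𝔭|)`,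
as an identity of rational numbers. -/
theorem stmt3 {D : Type*} [CommRing D] [IsDomain D] [IsDedekindDomain D]
    (I : Ideal D) (hI : I ≠ ⊥) [Finite (D ⧸ I)] :
    (Nat.card (D ⧸ I)ˣ : ℚ) =
      (Nat.card (D ⧸ I) : ℚ) *
        ∏ᶠ p ∈ {p : Ideal D | p.IsPrime ∧ I ≤ p},
          (1 - 1 / (Nat.card (D ⧸ p) : ℚ)) := by
  classical
  have mem_iff (P : Ideal D) :
      P ∈ (UniqueFactorizationMonoid.factors I).toFinset ↔ P.IsPrime ∧ I ≤ P := by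
    rw [Multiset.mem_toFinset, UniqueFactorizationMonoid.factors_eq_normalizedFactors,
      Ideal.mem_normalizedFactors_iff hI]
  have set_eq : {p : Ideal D | p.IsPrime ∧ I ≤ p} =
      ((UniqueFactorizationMonoid.factors I).toFinset : Set (Ideal D)) :=
    Set.ext fun P ↦ (mem_iff P).symm
  rw [set_eq, finprod_mem_coe_finset]
  let e := IsDedekindDomain.quotientEquivPiFactors hI
  rw [Nat.card_congr ((Units.mapEquiv e.toMulEquiv).trans MulEquiv.piUnits).toEquiv,
    Nat.card_congr e.toEquiv, Nat.card_pi, Nat.card_pi, Nat.cast_prod, Nat.cast_prod,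
    ← Finset.prod_coe_sort (UniqueFactorizationMonoid.factors I).toFinset,
    ← Finset.prod_mul_distrib]
  refine Finset.prod_congr rfl fun P _ ↦ ?_
  obtain ⟨hP, hIP⟩ := (mem_iff P).mp P.2
  have : (P : Ideal D).IsMaximal := hP.isMaximal (ne_bot_of_le_ne_bot hI hIP)
  have hn : (UniqueFactorizationMonoid.factors I).count (P : Ideal D) ≠ 0 :=
    Multiset.count_ne_zero.mpr (Multiset.mem_toFinset.mp P.2)
  have : Finite (D ⧸ (P : Ideal D) ^ (UniqueFactorizationMonoid.factors I).count (P : Ideal D)) :=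
    Finite.of_surjective _ ((Function.surjective_eval P).comp e.surjective)
  exact Ideal.natCard_units_quotient_pow (P : Ideal D) hn
end

section
/- Let D be a Dedekind domain that is not a field, such that D⧸𝔭 is finite for every nonzero prime ideal 𝔭, and such that for every natural number n there are only finitely many nonzero prime ideals 𝔭 with Nat.card(D⧸𝔭) ≤ n. Then every nonzero ideal I of D has finite quotient D⧸I, and for every real ε > 0 there exists a real constant C > 0 such that for every nonzero ideal I of D one has ∏_{𝔭 prime, 𝔭 ⊇ I} (1 − 1/Nat.card(D⧸𝔭)) ≥ C · Nat.card(D⧸I)^{−ε}. -/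
/-- The product of the norms of finitely many maximal ideals containing `I` is at most the norm
of `I`. -/
theorem Ideal.prod_natCard_quotient_le {R : Type*} [CommRing R] (I : Ideal R) [Finite (R ⧸ I)]
    (s : Finset (Ideal R)) (hmax : ∀ p ∈ s, p.IsMaximal) (hle : ∀ p ∈ s, I ≤ p) :
    ∏ p ∈ s, Nat.card (R ⧸ p) ≤ Nat.card (R ⧸ I) := by
  have hcop : Pairwise (Function.onFun IsCoprime fun p : s ↦ (p : Ideal R)) := fun p q hpq ↦
    have := hmax p p.2
    have := hmax q q.2
    Ideal.isCoprime_of_isMaximal (Subtype.coe_injective.ne hpq)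
  let f : R ⧸ I → ∀ p : s, R ⧸ (p : Ideal R) := fun x p ↦ Ideal.Quotient.factor (hle p p.2) x
  have hf : Function.Surjective f := fun y ↦ by
    obtain ⟨r, hr⟩ := Ideal.pi_quotient_surjective hcop y
    exact ⟨Ideal.Quotient.mk I r, funext hr⟩
  calc ∏ p ∈ s, Nat.card (R ⧸ p) = Nat.card (∀ p : s, R ⧸ (p : Ideal R)) := by
        rw [Nat.card_pi, Finset.prod_coe_sort s fun p ↦ Nat.card (R ⧸ p)]
    _ ≤ Nat.card (R ⧸ I) := Nat.card_le_card_of_surjective f hf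

/-- A Dedekind domain with finite residue fields at its nonzero primes has finite quotients. -/
theorem IsDedekindDomain.hasFiniteQuotients_of_isPrime {D : Type*} [CommRing D]
    [IsDedekindDomain D] (hres : ∀ p : Ideal D, p ≠ ⊥ → p.IsPrime → Finite (D ⧸ p)) :
    Ring.HasFiniteQuotients D where
  finiteQuotient {I} hI := by
    induction I using UniqueFactorizationMonoid.induction_on_prime with
    | h₁ => exact absurd rfl hI
    | h₂ J hJ =>
      rw [Ideal.isUnit_iff.mp hJ]
      infer_instance
    | h₃ J p hJ hp ih =>
      have := ih hJ
      have := hres p hp.ne_zero (Ideal.isPrime_of_prime hp)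
      exact Submodule.finite_quotient_smul p (IsNoetherian.noetherian J)

theorem Real.exists_nat_forall_rpow_neg_le_half {ε : ℝ} (hε : 0 < ε) :
    ∃ n : ℕ, ∀ m : ℕ, n < m → (m : ℝ) ^ (-ε) ≤ 1 / 2 := by
  have h := ((tendsto_rpow_neg_atTop hε).comp tendsto_natCast_atTop_atTop).eventually_le_const
    (show (0 : ℝ) < 1 / 2 by norm_num)
  obtain ⟨n, hn⟩ := Filter.eventually_atTop.mp h
  exact ⟨n, fun m hm ↦ hn m hm.le⟩


/-- Let `D` be a Dedekind domain that is not a field, with finite residue fields and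
only finitely many nonzero primes of bounded norm.  Then every nonzero ideal has finite
quotient, and for every `ε > 0` there is a constant `C > 0` such that for every nonzero
ideal `I`, `∏_{𝔭 prime, 𝔭 ⊇ I} (1 − 1/|D⧸𝔭|) ≥ C · |D⧸I|^{-ε}`. -/
theorem stmt4 {D : Type*} [CommRing D] [IsDomain D] [IsDedekindDomain D]
    (hD : ¬ IsField D)
    (hres : ∀ p : Ideal D, p ≠ ⊥ → p.IsPrime → Finite (D ⧸ p))
    (hbdd : ∀ n : ℕ, {p : Ideal D | p ≠ ⊥ ∧ p.IsPrime ∧ Nat.card (D ⧸ p) ≤ n}.Finite) :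
    (∀ I : Ideal D, I ≠ ⊥ → Finite (D ⧸ I)) ∧
      ∀ ε : ℝ, 0 < ε → ∃ C : ℝ, 0 < C ∧
        ∀ I : Ideal D, I ≠ ⊥ →
          (∏ᶠ p ∈ {p : Ideal D | p.IsPrime ∧ I ≤ p},
              (1 - 1 / (Nat.card (D ⧸ p) : ℝ))) ≥
            C * (Nat.card (D ⧸ I) : ℝ) ^ (-ε) := by
  classical
  have hfin : Ring.HasFiniteQuotients D := IsDedekindDomain.hasFiniteQuotients_of_isPrime hres
  refine ⟨fun _ ↦ hfin.finiteQuotient, fun ε hε ↦ ?_⟩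
  obtain ⟨n, hn⟩ := Real.exists_nat_forall_rpow_neg_le_half hε
  set small := (hbdd n).toFinset
  refine ⟨(1 / 2) ^ small.card, by positivity, fun I hI ↦ ?_⟩
  have := hfin.finiteQuotient hI
  have hne {p : Ideal D} (h : I ≤ p) : p ≠ ⊥ := ne_bot_of_le_ne_bot hI h
  have hS : {p : Ideal D | p.IsPrime ∧ I ≤ p}.Finite := by
    have := UniqueFactorizationMonoid.fintypeSubtypeDvd I hI
    have hdvd : {p : Ideal D | p ∣ I}.Finite :=
      Set.finite_coe_iff.mp (Finite.of_fintype {p // p ∣ I})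
    exact hdvd.subset fun p hp ↦ Ideal.dvd_iff_le.mpr hp.2
  set s := hS.toFinset with hs
  have mem_s {p : Ideal D} : p ∈ s ↔ p.IsPrime ∧ I ≤ p := by simp [hs]
  have two_le {p : Ideal D} (hp : p ∈ s) : 2 ≤ Nat.card (D ⧸ p) := by
    obtain ⟨hprime, hle⟩ := mem_s.mp hp
    have := hfin.finiteQuotient (hne hle)
    have := Ideal.Quotient.nontrivial_iff.mpr hprime.ne_top
    exact Finite.one_lt_card
  have hprod : ((Nat.card (D ⧸ I) : ℕ) : ℝ) ^ (-ε) ≤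
      ∏ p ∈ s, (Nat.card (D ⧸ p) : ℝ) ^ (-ε) := by
    rw [Real.finsetProd_rpow _ _ fun _ _ ↦ Nat.cast_nonneg _, ← Nat.cast_prod]
    refine Real.rpow_le_rpow_of_nonpos ?_ ?_ (neg_nonpos.mpr hε.le)
    · exact_mod_cast Finset.prod_pos fun p hp ↦ zero_lt_two.trans_le (two_le hp)
    · exact_mod_cast I.prod_natCard_quotient_le s
        (fun p hp ↦ (mem_s.mp hp).1.isMaximal (hne (mem_s.mp hp).2)) fun p hp ↦ (mem_s.mp hp).2
  have hconst : (1 / 2 : ℝ) ^ small.card ≤ ∏ p ∈ s, if p ∈ small then 1 / 2 else 1 := by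
    rw [Finset.prod_ite, Finset.prod_const, Finset.prod_const_one, mul_one]
    exact pow_le_pow_of_le_one (by norm_num) (by norm_num)
      (Finset.card_le_card fun p hp ↦ (Finset.mem_filter.mp hp).2)
  rw [finprod_mem_eq_finite_toFinset_prod _ hS, ge_iff_le]
  calc (1 / 2 : ℝ) ^ small.card * (Nat.card (D ⧸ I) : ℝ) ^ (-ε)
      ≤ (∏ p ∈ s, if p ∈ small then 1 / 2 else 1) *
          ∏ p ∈ s, (Nat.card (D ⧸ p) : ℝ) ^ (-ε) := by gcongr
    _ = ∏ p ∈ s, (if p ∈ small then 1 / 2 else 1) * (Nat.card (D ⧸ p) : ℝ) ^ (-ε) :=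
        Finset.prod_mul_distrib.symm
    _ ≤ ∏ p ∈ s, (1 - 1 / (Nat.card (D ⧸ p) : ℝ)) := by
      refine Finset.prod_le_prod (fun p _ ↦ by positivity) fun p hp ↦ ?_
      have h2 : (2 : ℝ) ≤ Nat.card (D ⧸ p) := by exact_mod_cast two_le hp
      have hhalf : 1 / (Nat.card (D ⧸ p) : ℝ) ≤ 1 / 2 :=
        one_div_le_one_div_of_le zero_lt_two h2
      split_ifs with hp_small
      · have := Real.rpow_le_one_of_one_le_of_nonpos (one_le_two.trans h2) (neg_nonpos.mpr hε.le)
        linarith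
      · obtain ⟨hprime, hle⟩ := mem_s.mp hp
        have hlt : n < Nat.card (D ⧸ p) := by
          by_contra! hcard
          exact hp_small ((hbdd n).mem_toFinset.mpr ⟨hne hle, hprime, hcard⟩)
        linarith [hn _ hlt]
end

section
/- With the order/conductor setup below: as rational numbers, Nat.card((A'⧸c)ˣ) ≥ Nat.card((R⧸c)ˣ) · Nat.card(A'⧸R) · ∏_{𝔭} (1 − 1/Nat.card(A'⧸𝔭)), where the product runs over the prime ideals 𝔭 of A' containing c, and A'⧸R denotes the quotient A-module. -/
/-- The units of a commutative ring are the preimage of the units of its quotient by a nilpotent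
ideal. -/
theorem Ideal.natCard_units_eq_mul_of_isNilpotent {B : Type*} [CommRing B] {I : Ideal B}
    (hI : IsNilpotent I) : Nat.card Bˣ = Nat.card I * Nat.card (B ⧸ I)ˣ := by
  have e : {b : B | IsUnit b} ≃ I × {x : B ⧸ I | IsUnit x} :=
    (Equiv.setCongr (Set.ext fun b => (hI.isUnit_quotient_mk_iff (x := b)).symm)).trans
      (QuotientAddGroup.preimageMkEquivAddSubgroupProdSet I.toAddSubgroup
        {x : B ⧸ I | IsUnit x})
  rw [Nat.card_congr (Submonoid.unitsTypeEquivIsUnitSubmonoid (M := B)).toEquiv,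
    Nat.card_congr (Submonoid.unitsTypeEquivIsUnitSubmonoid (M := B ⧸ I)).toEquiv,
    ← Nat.card_prod]
  exact Nat.card_congr e

/-- Euler's product formula for the number of units of a finite commutative ring. -/
theorem natCard_units_eq_mul_finprod (B : Type*) [CommRing B] [Finite B] :
    (Nat.card Bˣ : ℚ) =
      Nat.card B * ∏ᶠ m : MaximalSpectrum B, (1 - 1 / (Nat.card (B ⧸ m.asIdeal) : ℚ)) := by
  have := Fintype.ofFinite (MaximalSpectrum B)
  let e := IsArtinianRing.quotNilradicalEquivPi B
  have hunits : Nat.card (B ⧸ nilradical B)ˣ =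
      ∏ m : MaximalSpectrum B, Nat.card (B ⧸ m.asIdeal)ˣ := by
    rw [Nat.card_congr (Units.mapEquiv e.toMulEquiv).toEquiv,
      Nat.card_congr MulEquiv.piUnits.toEquiv, Nat.card_pi]
  have hquot : Nat.card (B ⧸ nilradical B) =
      ∏ m : MaximalSpectrum B, Nat.card (B ⧸ m.asIdeal) := by
    rw [Nat.card_congr e.toEquiv, Nat.card_pi]
  rw [Ideal.natCard_units_eq_mul_of_isNilpotent (IsArtinianRing.isNilpotent_nilradical),
    (nilradical B).card_eq_card_quotient_mul_card, hunits, hquot, finprod_eq_prod_of_fintype]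
  push_cast
  rw [mul_assoc, ← Finset.prod_mul_distrib]
  congr 1
  refine Finset.prod_congr rfl fun m _ => ?_
  let := Ideal.Quotient.field m.asIdeal
  have := Finite.of_surjective _ (Ideal.Quotient.mk_surjective (I := m.asIdeal))
  have h := Nat.card_eq_card_units_add_one (α := B ⧸ m.asIdeal)
  have h0 : (Nat.card (B ⧸ m.asIdeal) : ℚ) ≠ 0 := by
    rw [h]; positivity
  rw [mul_sub, mul_one_div_cancel h0, mul_one, eq_sub_iff_add_eq]
  exact_mod_cast h.symm

/-- The maximal ideals of a finite quotient `B ⧸ I` correspond to the primes of `B` above `I`,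
with the same residue rings. -/
theorem Ideal.finprod_maximalSpectrum_quotient {B M : Type*} [CommRing B] [CommMonoid M]
    (I : Ideal B) [Finite (B ⧸ I)] (f : ℕ → M) :
    ∏ᶠ m : MaximalSpectrum (B ⧸ I), f (Nat.card ((B ⧸ I) ⧸ m.asIdeal)) =
      ∏ᶠ p ∈ {p : Ideal B | p.IsPrime ∧ I ≤ p}, f (Nat.card (B ⧸ p)) := by
  have hs : Function.Surjective (Ideal.Quotient.mk I) := Ideal.Quotient.mk_surjective
  rw [← finprod_mem_univ]
  refine finprod_mem_eq_of_bijOn (fun m => m.asIdeal.comap (Ideal.Quotient.mk I))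
    ⟨fun m _ => ⟨m.isMaximal.isPrime.comap _, ?_⟩, fun m _ n _ h => ?_, fun p hp => ?_⟩
    fun m _ => ?_
  · simpa only [Ideal.mk_ker] using Ideal.ker_le_comap (K := m.asIdeal) (Ideal.Quotient.mk I)
  · exact MaximalSpectrum.ext (Ideal.comap_injective_of_surjective _ hs h)
  · obtain ⟨hp, hIp⟩ := hp
    have hprime : (p.map (Ideal.Quotient.mk I)).IsPrime :=
      Ideal.map_isPrime_of_surjective hs (by rwa [Ideal.mk_ker])
    exact ⟨⟨p.map (Ideal.Quotient.mk I), Ideal.IsPrime.isMaximal' hprime⟩, Set.mem_univ _,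
      Ideal.comap_map_mk hIp⟩
  · congr 1
    exact (Nat.card_congr (Equiv.ofBijective (Ideal.quotientMap m.asIdeal _ le_rfl)
      ⟨Ideal.quotientMap_injective, Ideal.quotientMap_surjective hs⟩)).symm

/-- A ring `B` finite over `A` is finite modulo the conductor of a subalgebra `R` such that
`B ⧸ R` is finite. -/
theorem Subalgebra.finite_quotient_of_forall_mul_mem {A B : Type*} [CommRing A] [CommRing B]
    [Algebra A B] [Module.Finite A B] (R : Subalgebra A B)
    [Finite (B ⧸ Subalgebra.toSubmodule R)] (c : Ideal B)
    (hc : ∀ x : B, (∀ y : B, x * y ∈ R) → x ∈ c) : Finite (B ⧸ c) := by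
  obtain ⟨s, hs⟩ := Module.Finite.fg_top (R := A) (M := B)
  let f : B →ₗ[A] s → B ⧸ Subalgebra.toSubmodule R :=
    LinearMap.pi fun y => (Subalgebra.toSubmodule R).mkQ ∘ₗ LinearMap.mulRight A (y : B)
  have hf : f.ker ≤ c.restrictScalars A := by
    intro x hx
    refine hc x fun y => ?_
    have hspan : Submodule.span A (s : Set B) ≤
        (Subalgebra.toSubmodule R).comap (LinearMap.mulLeft A x) := by
      refine Submodule.span_le.mpr fun y hy => ?_
      simpa [f] using congrFun (LinearMap.mem_ker.mp hx) ⟨y, hy⟩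
    exact hspan (hs ▸ Submodule.mem_top)
  have : Finite (B ⧸ f.ker) := Finite.of_injective _ f.quotKerEquivRange.injective
  exact Finite.of_surjective _ (Submodule.factor_surjective hf)

/-- Transitivity of the index for an ideal `c` contained in a subalgebra `R`. -/
theorem Subalgebra.natCard_quotient_comap_mul_natCard_quotient {A B : Type*} [CommRing A]
    [CommRing B] [Algebra A B] (R : Subalgebra A B) (c : Ideal B) (hcR : ∀ x ∈ c, x ∈ R) :
    Nat.card (R ⧸ c.comap R.val.toRingHom) * Nat.card (B ⧸ Subalgebra.toSubmodule R) =
      Nat.card (B ⧸ c) :=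
  AddSubgroup.relIndex_mul_index (H := c.toAddSubgroup)
    (K := (Subalgebra.toSubmodule R).toAddSubgroup) hcR

/-- Order/conductor setup as in the proof of Proposition 2.3(2): `A` a Dedekind domain
with fraction field `K`, `K'` a finite extension of degree `r`, `A'` the integral closure
of `A` in `K'` (finitely generated as an `A`-module), `R` an `A`-subalgebra of `A'` with
finite quotient `A`-module `A'⧸R`, and `c = {x ∈ A' : x·A' ⊆ R}` the conductor, regarded
both as an ideal of `A'` and (by restriction) of `R`.  Then, as rational numbers,
`|(A'⧸c)ˣ| ≥ |(R⧸c)ˣ| · |A'⧸R| · ∏_{𝔭 prime, 𝔭 ⊇ c} (1 − 1/|A'⧸𝔭|)`. -/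
theorem stmt5
    {A K K' A' : Type*} [CommRing A] [IsDomain A] [IsDedekindDomain A]
    [Field K] [Algebra A K] [IsFractionRing A K]
    [Field K'] [Algebra K K'] [FiniteDimensional K K']
    (r : ℕ) (hr : Module.finrank K K' = r)
    [CommRing A'] [IsDomain A'] [Algebra A A'] [Algebra A' K'] [Algebra A K']
    [IsScalarTower A A' K'] [IsScalarTower A K K']
    [IsIntegralClosure A' A K']
    [Module.Finite A A']
    (R : Subalgebra A A') [Finite (A' ⧸ Subalgebra.toSubmodule R)]
    (c : Ideal A') (hc : ∀ x : A', x ∈ c ↔ ∀ y : A', x * y ∈ R) :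
    (Nat.card (A' ⧸ c)ˣ : ℚ) ≥
      (Nat.card (R ⧸ Ideal.comap R.val.toRingHom c)ˣ : ℚ) *
        (Nat.card (A' ⧸ Subalgebra.toSubmodule R) : ℚ) *
        ∏ᶠ p ∈ {p : Ideal A' | p.IsPrime ∧ c ≤ p},
          (1 - 1 / (Nat.card (A' ⧸ p) : ℚ)) := by
  have hcR : ∀ x ∈ c, x ∈ R := fun x hx => by simpa using (hc x).mp hx 1
  have := R.finite_quotient_of_forall_mul_mem c fun x => (hc x).mpr
  have hindex := R.natCard_quotient_comap_mul_natCard_quotient c hcR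
  have hfin : Finite (R ⧸ c.comap R.val.toRingHom) := by
    refine Nat.finite_of_card_ne_zero fun h => ?_
    rw [h, zero_mul] at hindex
    exact Nat.card_pos.ne hindex
  have hunits : Nat.card (R ⧸ c.comap R.val.toRingHom)ˣ ≤
      Nat.card (R ⧸ c.comap R.val.toRingHom) :=
    Nat.card_le_card_of_injective _ Units.val_injective
  rw [natCard_units_eq_mul_finprod (A' ⧸ c),
    c.finprod_maximalSpectrum_quotient fun n => 1 - 1 / (n : ℚ), ← hindex, Nat.cast_mul]
  have hprod : 0 ≤ ∏ᶠ p ∈ {p : Ideal A' | p.IsPrime ∧ c ≤ p},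
      (1 - 1 / (Nat.card (A' ⧸ p) : ℚ)) :=
    finprod_mem_induction (0 ≤ ·) zero_le_one (fun _ _ => mul_nonneg) fun p _ => sub_nonneg.mpr (by simpa using Nat.cast_inv_le_one _)
  gcongr
end

section
/- Let A be a commutative ring such that for every natural number n there are only finitely many ideals I of A whose quotient A⧸I is finite of cardinality at most n, and let M be a finitely generated A-module. Then for every natural number B, there are only finitely many A-submodules N of M such that the quotient M⧸N is finite of cardinality at most B. -/
/-- If `A ⧸ I` is finite and `M` is finitely generated, only finitely many submodules of `M`
contain `I • M`. -/
theorem Submodule.finite_setOf_smul_top_le {A M : Type*} [CommRing A] [AddCommGroup M]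
    [Module A M] [Module.Finite A M] (I : Ideal A) [Finite (A ⧸ I)] :
    {N : Submodule A M | I • (⊤ : Submodule A M) ≤ N}.Finite := by
  have : Module.Finite (A ⧸ I) (M ⧸ I • (⊤ : Submodule A M)) :=
    Module.Finite.of_restrictScalars_finite A _ _
  have : Finite (M ⧸ I • (⊤ : Submodule A M)) := Module.finite_of_finite (A ⧸ I)
  refine (Set.finite_range (Submodule.comap (I • (⊤ : Submodule A M)).mkQ)).subset ?_
  intro N hN
  exact ⟨N.map (I • (⊤ : Submodule A M)).mkQ, by
    rw [Submodule.comap_map_mkQ, sup_eq_right]; exact hN⟩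

/-- If `M` is generated by `r` elements and `M ⧸ N` is finite, then `M ⧸ N` is killed by an ideal
of index at most `Nat.card (M ⧸ N) ^ r`. -/
theorem Submodule.exists_ideal_smul_top_le {A M : Type*} [CommRing A] [AddCommGroup M]
    [Module A M] {r : ℕ} (s : Fin r → M) (hs : Submodule.span A (Set.range s) = ⊤)
    (N : Submodule A M) [Finite (M ⧸ N)] :
    ∃ I : Ideal A, Finite (A ⧸ I) ∧ Nat.card (A ⧸ I) ≤ Nat.card (M ⧸ N) ^ r ∧
      I • (⊤ : Submodule A M) ≤ N := by
  let f : A →ₗ[A] (Fin r → M ⧸ N) :=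
    LinearMap.pi fun i => LinearMap.toSpanSingleton A (M ⧸ N) (N.mkQ (s i))
  have hf : Function.Injective ((LinearMap.range f).subtype ∘ f.quotKerEquivRange) :=
    Subtype.val_injective.comp f.quotKerEquivRange.injective
  refine ⟨LinearMap.ker f, Finite.of_injective _ hf, ?_, ?_⟩
  · simpa [Nat.card_fun] using Nat.card_le_card_of_injective _ hf
  · rw [← hs, Submodule.smul_le]
    intro a ha m hm
    have hle : Submodule.span A (Set.range s) ≤ N.comap (LinearMap.lsmul A M a) := by
      rw [Submodule.span_le]
      rintro _ ⟨i, rfl⟩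
      have h : a • N.mkQ (s i) = 0 := congrFun (LinearMap.mem_ker.mp ha) i
      rw [← map_smul] at h
      exact (Submodule.Quotient.mk_eq_zero N).mp h
    exact hle hm

/-- If `A` is a commutative ring in which, for every `n`, there are only finitely many
ideals of finite index at most `n`, and `M` is a finitely generated `A`-module, then for
every bound `B` there are only finitely many submodules `N ⊆ M` with finite quotient of
cardinality at most `B`. -/
theorem stmt8 {A : Type*} [CommRing A]
    (hA : ∀ n : ℕ, {I : Ideal A | Finite (A ⧸ I) ∧ Nat.card (A ⧸ I) ≤ n}.Finite)
    {M : Type*} [AddCommGroup M] [Module A M] [Module.Finite A M]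
    (B : ℕ) :
    {N : Submodule A M | Finite (M ⧸ N) ∧ Nat.card (M ⧸ N) ≤ B}.Finite := by
  obtain ⟨r, s, hs⟩ := Module.Finite.exists_fin (R := A) (M := M)
  refine ((hA (B ^ r)).biUnion (t := fun I => {N : Submodule A M | I • (⊤ : Submodule A M) ≤ N})
    fun I hI => ?_).subset ?_
  · have := hI.1
    exact Submodule.finite_setOf_smul_top_le I
  · rintro N ⟨hfin, hcard⟩
    obtain ⟨I, hI, hIcard, hle⟩ := Submodule.exists_ideal_smul_top_le s hs N
    exact Set.mem_biUnion (x := I) ⟨hI, hIcard.trans (Nat.pow_le_pow_left hcard r)⟩ hle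
end
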